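/- arXiv:1710.05355 — 4 statements merged into one kernel-verified Lean document; each statement's English description precedes it below -/
import Mathlib

section
/- Let u ≥ 1 be an integer and n = 2u + 1. Let μ_k = ((n+k−2)!/(k!·(n−1)!))·(n+2k−1) for k ≥ 0. Then for every complex s with Re s > n/2, the series Σ_{k=0}^{∞} μ_k·(k+u)^{-2s} converges absolutely and Σ_{k=0}^{∞} μ_k·(k+u)^{-2s} = (2/(2u)!)·Σ_{i=1}^{u} K_i^u·ζ(2s − 2i), where ζ is the Riemann zeta function. -/
open Finset Complex

/-- The product `∏ (m² - q²)` over `q ≤ u`, at `m = k + u + 1`, is `m (m + u)! / (m - u - 1)!`. -/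
theorem prod_sq_sub_sq_mul_factorial (u k : ℕ) :
    (∏ q ∈ Finset.range (u + 1), (((k + u + 1 : ℕ) : ℝ) ^ 2 - (q : ℝ) ^ 2)) * Nat.factorial k =
      ((k + u + 1 : ℕ) : ℝ) * Nat.factorial (k + 2 * u + 1) := by
  induction u generalizing k with
  | zero => simp [Nat.factorial_succ]; ring
  | succ u ih =>
    have h := ih (k + 1)
    rw [show k + 1 + u + 1 = k + (u + 1) + 1 by ring,
      show k + 1 + 2 * u + 1 = k + 2 * u + 2 by ring, Nat.factorial_succ k] at h
    rw [Finset.prod_range_succ, show k + 2 * (u + 1) + 1 = (k + 2 * u + 2) + 1 by ring,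
      Nat.factorial_succ (k + 2 * u + 2)]
    push_cast at h ⊢
    linear_combination ((k : ℝ) + 2 * u + 3) * h

/-- A polynomial in `m²` without constant term, times `m ^ (-2s)`, as a sum of powers. -/
theorem sum_mul_one_div_cpow (u : ℕ) (K : ℕ → ℝ) (s : ℂ) {m : ℕ} (hm : m ≠ 0) :
    ∑ i ∈ Finset.Icc 1 u, (K i : ℂ) * (1 / (m : ℂ) ^ (2 * s - 2 * (i : ℂ))) =
      ((∑ i ∈ Finset.Icc 1 u, K i * (m : ℝ) ^ (2 * i) : ℝ) : ℂ) * (m : ℂ) ^ (-(2 * s)) := by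
  have hm' : (m : ℂ) ≠ 0 := Nat.cast_ne_zero.mpr hm
  push_cast
  rw [Finset.sum_mul]
  refine Finset.sum_congr rfl fun i _ => ?_
  rw [one_div, ← cpow_neg, show -(2 * s - 2 * (i : ℂ)) = ((2 * i : ℕ) : ℂ) + -(2 * s) by
    push_cast; ring, cpow_add _ _ hm', cpow_natCast, mul_assoc]

/-- Let u ≥ 1, n = 2u+1, and μ_k = ((n+k−2)!/(k!·(n−1)!))·(n+2k−1). Let
K₁ᵘ, …, K_uᵘ be defined by ∏_{q=0}^{u−1}(X² − q²) = Σ_{i=1}^{u} Kᵢᵘ X^{2i} for all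
real X. Then for every complex s with Re s > n/2, the series Σ_k μ_k·(k+u)^{-2s}
converges absolutely and equals (2/(2u)!)·Σ_{i=1}^{u} Kᵢᵘ·ζ(2s − 2i). -/
theorem stmt_3 (u : ℕ) (hu : 1 ≤ u) (n : ℕ) (hn : n = 2 * u + 1)
    (μ : ℕ → ℝ)
    (hμ : ∀ k, μ k = ((Nat.factorial (n + k - 2) : ℝ) /
      ((Nat.factorial k) * (Nat.factorial (n - 1)))) * ((n : ℝ) + 2 * k - 1))
    (K : ℕ → ℝ)
    (hK : ∀ X : ℝ, ∏ q ∈ Finset.range u, (X ^ 2 - (q : ℝ) ^ 2) =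
      ∑ i ∈ Finset.Icc 1 u, K i * X ^ (2 * i)) :
    ∀ s : ℂ, (n : ℝ) / 2 < s.re →
      Summable (fun k : ℕ =>
        ‖(μ k : ℂ) * (((k : ℝ) + u : ℝ) : ℂ) ^ (-(2 * s))‖) ∧
      ∑' k : ℕ, (μ k : ℂ) * (((k : ℝ) + u : ℝ) : ℂ) ^ (-(2 * s)) =
        (2 / (Nat.factorial (2 * u) : ℂ)) *
          ∑ i ∈ Finset.Icc 1 u, (K i : ℂ) * riemannZeta (2 * s - 2 * (i : ℂ)) := by
  intro s hs
  have hre : ∀ i ∈ Finset.Icc 1 u, 1 < (2 * s - 2 * (i : ℂ)).re := by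
    intro i hi
    have hi' : (i : ℝ) ≤ u := Nat.cast_le.mpr (Finset.mem_Icc.mp hi).2
    subst hn
    push_cast at hs
    simp only [sub_re, mul_re, re_ofNat, im_ofNat, natCast_re, natCast_im]
    linarith
  have hzeta : HasSum (fun m : ℕ => (2 / (Nat.factorial (2 * u) : ℂ)) *
      ∑ i ∈ Finset.Icc 1 u, (K i : ℂ) * (1 / (m : ℂ) ^ (2 * s - 2 * (i : ℂ))))
      ((2 / (Nat.factorial (2 * u) : ℂ)) *
        ∑ i ∈ Finset.Icc 1 u, (K i : ℂ) * riemannZeta (2 * s - 2 * (i : ℂ))) := by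
    refine (hasSum_sum fun i hi => ?_).mul_left _
    rw [zeta_eq_tsum_one_div_nat_cpow (hre i hi)]
    exact (Complex.summable_one_div_nat_cpow.mpr (hre i hi)).hasSum.mul_left _
  have hvanish : ∀ m ∈ Finset.range u, (2 / (Nat.factorial (2 * u) : ℂ)) *
      ∑ i ∈ Finset.Icc 1 u, (K i : ℂ) * (1 / (m : ℂ) ^ (2 * s - 2 * (i : ℂ))) = 0 := by
    intro m hm
    refine mul_eq_zero_of_right _ ?_
    rcases eq_or_ne m 0 with rfl | hm0
    · refine Finset.sum_eq_zero fun i hi => ?_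
      have h0 : 2 * s - 2 * (i : ℂ) ≠ 0 := by
        intro h
        have := hre i hi
        rw [h, zero_re] at this
        linarith
      rw [Nat.cast_zero, zero_cpow h0, div_zero, mul_zero]
    · rw [sum_mul_one_div_cpow u K s hm0, ← hK, Finset.prod_eq_zero hm (sub_self _),
        ofReal_zero, zero_mul]
  have hterm : ∀ k : ℕ, (2 / (Nat.factorial (2 * u) : ℂ)) *
      ∑ i ∈ Finset.Icc 1 u, (K i : ℂ) * (1 / ((k + u : ℕ) : ℂ) ^ (2 * s - 2 * (i : ℂ))) =
        (μ k : ℂ) * (((k : ℝ) + u : ℝ) : ℂ) ^ (-(2 * s)) := by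
    intro k
    have hμk : μ k = 2 / (Nat.factorial (2 * u) : ℝ) *
        ∏ q ∈ Finset.range u, (((k + u : ℕ) : ℝ) ^ 2 - (q : ℝ) ^ 2) := by
      obtain ⟨v, rfl⟩ := Nat.exists_eq_add_of_le' hu
      have h := prod_sq_sub_sq_mul_factorial v k
      have hk : (Nat.factorial k : ℝ) ≠ 0 := Nat.cast_ne_zero.mpr (Nat.factorial_ne_zero _)
      have hv : (Nat.factorial (2 * (v + 1)) : ℝ) ≠ 0 :=
        Nat.cast_ne_zero.mpr (Nat.factorial_ne_zero _)
      rw [hμ, hn, show 2 * (v + 1) + 1 + k - 2 = k + 2 * v + 1 by omega,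
        show 2 * (v + 1) + 1 - 1 = 2 * (v + 1) by omega, ← add_assoc k v 1, eq_div_of_mul_eq hk h]
      field_simp
      push_cast
      ring
    rw [sum_mul_one_div_cpow u K s (by omega), ← hK, hμk, ← mul_assoc]
    push_cast
    rfl
  have hsum : HasSum (fun k : ℕ => (μ k : ℂ) * (((k : ℝ) + u : ℝ) : ℂ) ^ (-(2 * s)))
      ((2 / (Nat.factorial (2 * u) : ℂ)) *
        ∑ i ∈ Finset.Icc 1 u, (K i : ℂ) * riemannZeta (2 * s - 2 * (i : ℂ))) := by
    have h := (hasSum_nat_add_iff' u).mpr hzeta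
    rw [Finset.sum_eq_zero hvanish, sub_zero] at h
    simpa only [hterm] using h
  exact ⟨hsum.summable.norm, hsum.tsum_eq⟩
end

section
/- Let u ≥ 1 be an integer and let F(s) := (2/(2u)!)·Σ_{i=1}^{u} K_i^u·ζ(2s − 2i), where ζ is the Riemann zeta function. Then for every integer j with 2 ≤ j ≤ u+1, F has a simple pole at s = j − 1/2 with lim_{s → j−1/2} (s − (j − 1/2))·F(s) = K_{j−1}^u/(2u)!, and F is analytic at s = −1/2 and at s = 1/2. -/
open Finset Complex Filter

theorem analyticAt_riemannZeta_two_mul_sub {s₀ c : ℂ} (h : 2 * s₀ - c ≠ 1) :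
    AnalyticAt ℂ (fun s : ℂ => riemannZeta (2 * s - c)) s₀ := by
  have hopen : IsOpen {s : ℂ | 2 * s - c ≠ 1} :=
    isOpen_ne_fun (by fun_prop) continuous_const
  refine DifferentiableOn.analyticAt (s := {s : ℂ | 2 * s - c ≠ 1}) ?_ (hopen.mem_nhds h)
  intro s hs
  exact ((differentiableAt_riemannZeta hs).comp s
    (by fun_prop : DifferentiableAt ℂ (fun s : ℂ => 2 * s - c) s)).differentiableWithinAt

theorem tendsto_sub_mul_riemannZeta_two_mul_sub_zero {s₀ c : ℂ} (h : 2 * s₀ - c ≠ 1) :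
    Tendsto (fun s : ℂ => (s - s₀) * riemannZeta (2 * s - c)) (nhdsWithin s₀ {s₀}ᶜ) (nhds 0) := by
  have hcont : ContinuousAt (fun s : ℂ => (s - s₀) * riemannZeta (2 * s - c)) s₀ :=
    (by fun_prop : ContinuousAt (fun s : ℂ => s - s₀) s₀).mul
      (analyticAt_riemannZeta_two_mul_sub h).continuousAt
  simpa using hcont.tendsto.mono_left nhdsWithin_le_nhds

theorem tendsto_sub_mul_riemannZeta_two_mul_sub_half {s₀ c : ℂ} (h : 2 * s₀ - c = 1) :
    Tendsto (fun s : ℂ => (s - s₀) * riemannZeta (2 * s - c)) (nhdsWithin s₀ {s₀}ᶜ)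
      (nhds (1 / 2)) := by
  have hmap : Tendsto (fun s : ℂ => 2 * s - c) (nhdsWithin s₀ {s₀}ᶜ) (nhdsWithin 1 {1}ᶜ) := by
    refine tendsto_nhdsWithin_iff.mpr ⟨?_, ?_⟩
    · have hcont : ContinuousAt (fun s : ℂ => 2 * s - c) s₀ := by fun_prop
      simpa [h] using hcont.tendsto.mono_left nhdsWithin_le_nhds
    · filter_upwards [self_mem_nhdsWithin] with s hs heq
      have heq : 2 * s - c = 1 := heq
      exact hs (by linear_combination (heq - h) / 2 : s = s₀)
  have hres := (riemannZeta_residue_one.comp hmap).const_mul (1 / 2 : ℂ)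
  rw [mul_one] at hres
  refine hres.congr fun s => ?_
  simp only [Function.comp_apply]
  linear_combination (h / 2) * riemannZeta (2 * s - c)

/-- Let u ≥ 1 and F(s) := (2/(2u)!)·Σ_{i=1}^{u} Kᵢᵘ·ζ(2s − 2i), where the Kᵢᵘ are
defined by ∏_{q=0}^{u−1}(X² − q²) = Σ_{i=1}^{u} KᵢᵘX^{2i} for all real X. Then for
every integer 2 ≤ j ≤ u+1, F has a simple pole at s = j − 1/2 with
lim_{s→j−1/2} (s − (j − 1/2))·F(s) = K_{j−1}ᵘ/(2u)!, and F is analytic at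
s = −1/2 and at s = 1/2. -/
theorem stmt_5 (u : ℕ) (hu : 1 ≤ u) (K : ℕ → ℝ)
    (hK : ∀ X : ℝ, ∏ q ∈ Finset.range u, (X ^ 2 - (q : ℝ) ^ 2) =
      ∑ i ∈ Finset.Icc 1 u, K i * X ^ (2 * i))
    (F : ℂ → ℂ)
    (hF : ∀ s : ℂ, F s = (2 / (Nat.factorial (2 * u) : ℂ)) *
      ∑ i ∈ Finset.Icc 1 u, (K i : ℂ) * riemannZeta (2 * s - 2 * (i : ℂ))) :
    (∀ j : ℕ, 2 ≤ j → j ≤ u + 1 →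
      Tendsto (fun s : ℂ => (s - ((j : ℂ) - 1 / 2)) * F s)
        (nhdsWithin ((j : ℂ) - 1 / 2) {((j : ℂ) - 1 / 2)}ᶜ)
        (nhds ((K (j - 1) : ℂ) / (Nat.factorial (2 * u) : ℂ)))) ∧
      AnalyticAt ℂ F (-1 / 2) ∧ AnalyticAt ℂ F (1 / 2) := by
  have hFeq : F = fun s : ℂ => (2 / (Nat.factorial (2 * u) : ℂ)) *
      ∑ i ∈ Finset.Icc 1 u, (K i : ℂ) * riemannZeta (2 * s - 2 * (i : ℂ)) := funext hF
  have hanalytic (s₀ : ℂ) (h : ∀ i ∈ Finset.Icc 1 u, 2 * s₀ - 2 * (i : ℂ) ≠ 1) :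
      AnalyticAt ℂ F s₀ := by
    rw [hFeq]
    exact analyticAt_const.mul <| Finset.analyticAt_fun_sum _ fun i hi =>
      analyticAt_const.mul (analyticAt_riemannZeta_two_mul_sub (h i hi))
  refine ⟨fun j hj hju => ?_, hanalytic _ fun i _ h => ?_, hanalytic _ fun i hi h => ?_⟩
  · have hterm (i : ℕ) : Tendsto
        (fun s : ℂ => (s - ((j : ℂ) - 1 / 2)) * riemannZeta (2 * s - 2 * (i : ℂ)))
        (nhdsWithin ((j : ℂ) - 1 / 2) {((j : ℂ) - 1 / 2)}ᶜ)
        (nhds (if i = j - 1 then 1 / 2 else 0)) := by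
      split_ifs with h
      · apply tendsto_sub_mul_riemannZeta_two_mul_sub_half
        have hij : (j : ℂ) = i + 1 := by exact_mod_cast (by omega : j = i + 1)
        rw [hij]
        ring
      · apply tendsto_sub_mul_riemannZeta_two_mul_sub_zero
        intro heq
        have hij : (j : ℂ) = (i + 1 : ℕ) := by
          push_cast
          linear_combination heq / 2
        have hij' : j = i + 1 := Nat.cast_injective hij
        omega
    have hsum := (tendsto_finsetSum (Finset.Icc 1 u)
      fun i _ => (hterm i).const_mul (K i : ℂ)).const_mul (2 / (Nat.factorial (2 * u) : ℂ))
    have hmem : j - 1 ∈ Finset.Icc 1 u := Finset.mem_Icc.mpr ⟨by omega, by omega⟩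
    simp only [mul_ite, mul_zero, Finset.sum_ite_eq', if_pos hmem] at hsum
    convert hsum using 2 with s
    · rw [hF, mul_left_comm, Finset.mul_sum]
      congr 1
      exact Finset.sum_congr rfl fun i _ => mul_left_comm _ _ _
    · ring
  · have hi : (i : ℂ) + 1 = 0 := by linear_combination -h / 2
    exact Nat.cast_add_one_ne_zero i hi
  · have hi0 : (i : ℂ) = 0 := by linear_combination -h / 2
    have hi1 := (Finset.mem_Icc.mp hi).1
    rw [Nat.cast_eq_zero] at hi0
    omega
end

section
/- Let v ≥ 1 be an integer and n = 4v + 1. Let μ_k = ((2k+n−2)!/((2k)!·(n−1)!))·(n+4k−1) for k ≥ 0. Then for every complex s with Re s > n/2, the series Σ_{k=0}^{∞} μ_k·(2k+2v)^{-2s} converges absolutely and Σ_{k=0}^{∞} μ_k·(2k+2v)^{-2s} = Σ_{i=1}^{2v} (2^{2i+1−2s}/(4v)!)·K_i^{2v}·ζ(2s − 2i), where ζ is the Riemann zeta function. -/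
open Finset Complex

/-- For `X = a + r + 1`, the product `∏_{q ≤ r} (X² - q²)` telescopes to
`X · (X + r)! / (X - r - 1)!`. -/
lemma prod_range_sq_sub_sq_mul_factorial (r a : ℕ) :
    (∏ q ∈ Finset.range (r + 1), (((a : ℝ) + r + 1) ^ 2 - (q : ℝ) ^ 2)) * (Nat.factorial a : ℝ) =
      ((a : ℝ) + r + 1) * (Nat.factorial (a + 2 * r + 1) : ℝ) := by
  induction r generalizing a with
  | zero =>
    simp [Nat.factorial_succ]
    ring
  | succ r ih =>
    have h := ih (a + 1)
    have e1 : a + 1 + 2 * r + 1 = a + 2 * r + 2 := by ring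
    have e2 : a + 2 * (r + 1) + 1 = (a + 2 * r + 2) + 1 := by ring
    have e3 : ((a + 1 : ℕ) : ℝ) + r + 1 = (a : ℝ) + (r + 1 : ℕ) + 1 := by push_cast; ring
    rw [e1, e3, Nat.factorial_succ a] at h
    rw [Finset.prod_range_succ, e2, Nat.factorial_succ (a + 2 * r + 2)]
    push_cast at h ⊢
    linear_combination ((a : ℝ) + 2 * r + 3) * h

/-- A Dirichlet series over the even numbers: `∑ (2m)^{2i} (2m)^{-2s} = 2^{2i-2s} ζ(2s-2i)`. -/
lemma hasSum_two_mul_pow_mul_cpow {i : ℕ} (hi : i ≠ 0) {s : ℂ}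
    (hs : 1 < (2 * s - 2 * (i : ℂ)).re) :
    HasSum (fun m : ℕ => (2 * (m : ℂ)) ^ (2 * i) * (2 * (m : ℂ)) ^ (-(2 * s)))
      ((2 : ℂ) ^ (2 * (i : ℂ) - 2 * s) * riemannZeta (2 * s - 2 * (i : ℂ))) := by
  have h : HasSum (fun m : ℕ => 1 / (m : ℂ) ^ (2 * s - 2 * (i : ℂ)))
      (riemannZeta (2 * s - 2 * (i : ℂ))) := by
    rw [zeta_eq_tsum_one_div_nat_cpow hs]
    exact (Complex.summable_one_div_nat_cpow.mpr hs).hasSum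
  refine (h.mul_left ((2 : ℂ) ^ (2 * (i : ℂ) - 2 * s))).congr_fun fun m => ?_
  rcases Nat.eq_zero_or_pos m with rfl | hm
  · have : 2 * s - 2 * (i : ℂ) ≠ 0 := Complex.ne_zero_of_one_lt_re hs
    simp [hi, Complex.zero_cpow this]
  · have hm' : (2 * (m : ℂ)) ≠ 0 := by
      have : (m : ℂ) ≠ 0 := by exact_mod_cast hm.ne'
      simpa using this
    rw [← Complex.cpow_natCast, ← Complex.cpow_add _ _ hm', one_div, ← Complex.cpow_neg]
    have e : ((2 * i : ℕ) : ℂ) + -(2 * s) = 2 * (i : ℂ) - 2 * s := by push_cast; ring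
    rw [e, neg_sub]
    exact_mod_cast Complex.natCast_mul_natCast_cpow 2 m (2 * (i : ℂ) - 2 * s)

/-- Let v ≥ 1, n = 4v+1, and μ_k = ((2k+n−2)!/((2k)!·(n−1)!))·(n+4k−1). Let
K₁^{2v}, …, K_{2v}^{2v} be defined by ∏_{q=0}^{2v−1}(X² − q²) =
Σ_{i=1}^{2v} Kᵢ^{2v} X^{2i} for all real X. Then for every complex s with
Re s > n/2, the series Σ_k μ_k·(2k+2v)^{-2s} converges absolutely and equals
Σ_{i=1}^{2v} (2^{2i+1−2s}/(4v)!)·Kᵢ^{2v}·ζ(2s − 2i). -/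
theorem stmt_6 (v : ℕ) (hv : 1 ≤ v) (n : ℕ) (hn : n = 4 * v + 1)
    (μ : ℕ → ℝ)
    (hμ : ∀ k, μ k = ((Nat.factorial (2 * k + n - 2) : ℝ) /
      ((Nat.factorial (2 * k)) * (Nat.factorial (n - 1)))) * ((n : ℝ) + 4 * k - 1))
    (K : ℕ → ℝ)
    (hK : ∀ X : ℝ, ∏ q ∈ Finset.range (2 * v), (X ^ 2 - (q : ℝ) ^ 2) =
      ∑ i ∈ Finset.Icc 1 (2 * v), K i * X ^ (2 * i)) :
    ∀ s : ℂ, (n : ℝ) / 2 < s.re →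
      Summable (fun k : ℕ =>
        ‖(μ k : ℂ) * ((2 * (k : ℝ) + 2 * v : ℝ) : ℂ) ^ (-(2 * s))‖) ∧
      ∑' k : ℕ, (μ k : ℂ) * ((2 * (k : ℝ) + 2 * v : ℝ) : ℂ) ^ (-(2 * s)) =
        ∑ i ∈ Finset.Icc 1 (2 * v),
          ((2 : ℂ) ^ (2 * (i : ℂ) + 1 - 2 * s) / (Nat.factorial (4 * v) : ℂ)) *
            (K i : ℂ) * riemannZeta (2 * s - 2 * (i : ℂ)) := by
  subst hn
  intro s hs
  set F : ℕ → ℂ := fun m =>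
    ∑ i ∈ Finset.Icc 1 (2 * v), (2 / (Nat.factorial (4 * v) : ℂ)) * (K i : ℂ) *
      ((2 * (m : ℂ)) ^ (2 * i) * (2 * (m : ℂ)) ^ (-(2 * s))) with hF
  have hsum : HasSum F (∑ i ∈ Finset.Icc 1 (2 * v),
      ((2 : ℂ) ^ (2 * (i : ℂ) + 1 - 2 * s) / (Nat.factorial (4 * v) : ℂ)) *
        (K i : ℂ) * riemannZeta (2 * s - 2 * (i : ℂ))) := by
    refine hasSum_sum fun i hi => ?_
    obtain ⟨hi1, hi2⟩ := Finset.mem_Icc.mp hi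
    have hre : 1 < (2 * s - 2 * (i : ℂ)).re := by
      have : (i : ℝ) ≤ 2 * v := by exact_mod_cast hi2
      simp only [sub_re, mul_re, re_ofNat, im_ofNat, natCast_re, natCast_im]
      push_cast at hs
      linarith
    have e : ((2 : ℂ) ^ (2 * (i : ℂ) + 1 - 2 * s) / (Nat.factorial (4 * v) : ℂ)) *
        (K i : ℂ) * riemannZeta (2 * s - 2 * (i : ℂ)) =
        (2 / (Nat.factorial (4 * v) : ℂ)) * (K i : ℂ) *
          ((2 : ℂ) ^ (2 * (i : ℂ) - 2 * s) * riemannZeta (2 * s - 2 * (i : ℂ))) := by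
      rw [show 2 * (i : ℂ) + 1 - 2 * s = (2 * (i : ℂ) - 2 * s) + 1 by ring,
        Complex.cpow_add _ _ two_ne_zero, Complex.cpow_one]
      ring
    rw [e]
    exact (hasSum_two_mul_pow_mul_cpow (by omega) hre).mul_left _
  have hFprod (m : ℕ) : F m = (2 / (Nat.factorial (4 * v) : ℂ)) *
      ((∏ q ∈ Finset.range (2 * v), ((2 * (m : ℝ)) ^ 2 - (q : ℝ) ^ 2) : ℝ) : ℂ) *
        (2 * (m : ℂ)) ^ (-(2 * s)) := by
    rw [hK]
    push_cast
    rw [hF, Finset.mul_sum, Finset.sum_mul]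
    exact Finset.sum_congr rfl fun i _ => by ring
  have hzero : ∀ m ∈ Finset.range v, F m = 0 := by
    intro m hm
    have hm' := Finset.mem_range.mp hm
    rw [hFprod, Finset.prod_eq_zero (i := 2 * m) (Finset.mem_range.mpr (by omega))
      (by push_cast; ring)]
    simp
  have hμP (k : ℕ) : μ k = 2 / (Nat.factorial (4 * v) : ℝ) *
      ∏ q ∈ Finset.range (2 * v), ((2 * ((k + v : ℕ) : ℝ)) ^ 2 - (q : ℝ) ^ 2) := by
    obtain ⟨r, hr⟩ : ∃ r, 2 * v = r + 1 := ⟨2 * v - 1, by omega⟩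
    have h := prod_range_sq_sub_sq_mul_factorial r (2 * k)
    have hr' : (2 : ℝ) * v = r + 1 := by exact_mod_cast hr
    have e1 : ((2 * k : ℕ) : ℝ) + r + 1 = 2 * ((k + v : ℕ) : ℝ) := by
      push_cast
      linarith
    rw [← hr, e1, show 2 * k + 2 * r + 1 = 2 * k + (4 * v + 1) - 2 by omega] at h
    rw [hμ, show 4 * v + 1 - 1 = 4 * v by omega, ← mul_right_cancel_iff_of_pos
      (show (0 : ℝ) < Nat.factorial (2 * k) by exact_mod_cast Nat.factorial_pos _),
      mul_assoc (2 / _), h]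
    field_simp
    push_cast
    ring
  have hterm (k : ℕ) : (μ k : ℂ) * ((2 * (k : ℝ) + 2 * v : ℝ) : ℂ) ^ (-(2 * s)) = F (k + v) := by
    rw [hFprod, hμP]
    push_cast
    rw [mul_add]
  have hshift := (hasSum_nat_add_iff' v).mpr hsum
  rw [Finset.sum_eq_zero hzero, sub_zero] at hshift
  simp only [hterm]
  exact ⟨hshift.summable.norm, hshift.tsum_eq⟩
end

section
/- Let v ≥ 1 be an integer. Then Σ_{i=1}^{2v} (2^{2i+2} − 1)·(B_{2i+2}·K_i^{2v})/(4·(i+1)·(4v)!) ≠ 0, where B_k are the Bernoulli numbers. -/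
open Finset

open Polynomial in
/-- The coefficients of `∏ q < n, (X - q²)` alternate in sign. -/
lemma neg_one_pow_mul_coeff_prod_X_sub_sq_nonneg (n i : ℕ) :
    0 ≤ (-1 : ℝ) ^ (n + i) *
      (∏ q ∈ Finset.range n, ((X : ℝ[X]) - C ((q : ℝ) ^ 2))).coeff i := by
  induction n generalizing i with
  | zero =>
    rw [Finset.prod_range_zero, coeff_one]
    split_ifs with h <;> simp [h]
  | succ n ih =>
    rw [Finset.prod_range_succ, mul_sub, coeff_sub, coeff_mul_C]
    cases i with
    | zero =>
      rw [coeff_mul_X_zero]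
      have h := mul_nonneg (ih 0) (sq_nonneg (n : ℝ))
      exact h.trans_eq (by ring)
    | succ i =>
      rw [coeff_mul_X]
      have h := add_nonneg (ih i) (mul_nonneg (ih (i + 1)) (sq_nonneg (n : ℝ)))
      exact h.trans_eq (by ring)

open Polynomial in
/-- A polynomial is determined by its values on squares. -/
lemma coeff_eq_of_eval_sq_eq_sum {p : ℝ[X]} {s : Finset ℕ} {K : ℕ → ℝ}
    (h : ∀ x : ℝ, p.eval (x ^ 2) = ∑ i ∈ s, K i * x ^ (2 * i)) {i : ℕ} (hi : i ∈ s) :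
    p.coeff i = K i := by
  have hp : p = ∑ i ∈ s, C (K i) * X ^ i := by
    apply expand_injective two_pos
    apply Polynomial.funext
    intro x
    rw [expand_eval, expand_eval, h, eval_finsetSum]
    simp [pow_mul]
  simp [hp, coeff_C_mul, coeff_X_pow, hi]

/-- The Bernoulli numbers of positive even index alternate in sign. -/
lemma neg_one_pow_mul_bernoulli_two_mul_pos {k : ℕ} (hk : k ≠ 0) :
    0 < (-1 : ℝ) ^ (k + 1) * (bernoulli (2 * k) : ℝ) := by
  have h := hasSum_zeta_nat hk
  have hpos : 0 < ∑' n : ℕ, 1 / (n : ℝ) ^ (2 * k) :=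
    h.summable.tsum_pos (fun n => by positivity) 1 (by simp)
  rw [h.tsum_eq] at hpos
  have hc : (0 : ℝ) < 2 ^ (2 * k - 1) * Real.pi ^ (2 * k) / (2 * k).factorial := by
    have := Real.pi_pos
    positivity
  refine pos_of_mul_pos_left (b := 2 ^ (2 * k - 1) * Real.pi ^ (2 * k) / (2 * k).factorial) ?_ hc.le
  exact hpos.trans_eq (by ring)

/-- Let v ≥ 1, and let K₁^{2v}, …, K_{2v}^{2v} be defined by
∏_{q=0}^{2v−1}(X² − q²) = Σ_{i=1}^{2v} Kᵢ^{2v} X^{2i} for all real X. Then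
Σ_{i=1}^{2v} (2^{2i+2} − 1)·(B_{2i+2}·Kᵢ^{2v})/(4·(i+1)·(4v)!) ≠ 0,
where B_k are the Bernoulli numbers. -/
theorem stmt_8 (v : ℕ) (hv : 1 ≤ v) (K : ℕ → ℝ)
    (hK : ∀ X : ℝ, ∏ q ∈ Finset.range (2 * v), (X ^ 2 - (q : ℝ) ^ 2) =
      ∑ i ∈ Finset.Icc 1 (2 * v), K i * X ^ (2 * i)) :
    ∑ i ∈ Finset.Icc 1 (2 * v),
      ((2 : ℝ) ^ (2 * i + 2) - 1) * ((bernoulli (2 * i + 2) : ℝ) * K i) /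
        (4 * ((i : ℝ) + 1) * (Nat.factorial (4 * v))) ≠ 0 := by
  have hcoeff : ∀ i ∈ Finset.Icc 1 (2 * v), (∏ q ∈ Finset.range (2 * v),
      ((Polynomial.X : Polynomial ℝ) - Polynomial.C ((q : ℝ) ^ 2))).coeff i = K i := fun i hi =>
    coeff_eq_of_eval_sq_eq_sum (fun x => by rw [← hK x, Polynomial.eval_prod]; simp) hi
  have hB : ∀ i : ℕ, 0 < (-1 : ℝ) ^ i * (bernoulli (2 * i + 2) : ℝ) := fun i => by
    simpa [pow_succ, mul_add] using neg_one_pow_mul_bernoulli_two_mul_pos i.succ_ne_zero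
  have hKsign : ∀ i ∈ Finset.Icc 1 (2 * v), 0 ≤ (-1 : ℝ) ^ i * K i := fun i hi => by
    have h := neg_one_pow_mul_coeff_prod_X_sub_sq_nonneg (2 * v) i
    rw [hcoeff i hi] at h
    simpa [pow_add, pow_mul] using h
  have hBK : ∀ i : ℕ, (bernoulli (2 * i + 2) : ℝ) * K i =
      ((-1) ^ i * (bernoulli (2 * i + 2) : ℝ)) * ((-1) ^ i * K i) := fun i => by
    rw [mul_mul_mul_comm, ← mul_pow]
    simp
  have hpow : ∀ i : ℕ, (0 : ℝ) < 2 ^ (2 * i + 2) - 1 := fun i =>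
    sub_pos.2 (one_lt_pow₀ one_lt_two (by omega))
  have htop : 2 * v ∈ Finset.Icc 1 (2 * v) := Finset.mem_Icc.2 ⟨by omega, le_rfl⟩
  have hKtop : K (2 * v) = 1 := by
    have hmonic := Polynomial.monic_prod_X_sub_C (fun q : ℕ => (q : ℝ) ^ 2) (Finset.range (2 * v))
    rw [Polynomial.Monic, Polynomial.leadingCoeff, Polynomial.natDegree_finsetProd_X_sub_C_eq_card,
      Finset.card_range] at hmonic
    rw [← hcoeff _ htop, hmonic]
  refine (Finset.sum_pos' (fun i hi => ?_) ⟨2 * v, htop, ?_⟩).ne'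
  · rw [hBK]
    exact div_nonneg (mul_nonneg (hpow i).le (mul_nonneg (hB i).le (hKsign i hi))) (by positivity)
  · rw [hBK, hKtop]
    exact div_pos (mul_pos (hpow _) (mul_pos (hB _) (by simp))) (by positivity)
end
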